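/- (Kreweras's determinant formula.) Let Y = (y₁ ≥ ⋯ ≥ y_h) and Y' = (y'₁ ≥ ⋯ ≥ y'_h) be weakly decreasing h-tuples of nonnegative integers with y'_i ≤ y_i for all i. Then for every r ≥ 0, the number w_r of multichains Y' ≤ Z₁ ≤ ⋯ ≤ Z_r ≤ Y equals the determinant of the h×h matrix whose (i,j) entry is the binomial coefficient C(y_i − y'_j + r, i − j + r), with the convention that C(a,b) = 0 unless 0 ≤ b ≤ a. -/

import Mathlib

open scoped Classical

/-- `v` is a weakly decreasing `h`-tuple. -/
def IsDecr (h : ℕ) (v : Fin h → ℕ) : Prop := ∀ i j : Fin h, i ≤ j → v j ≤ v i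

/-- The binomial coefficient `C(a, b)` for integers `a, b`: the usual binomial
coefficient when `0 ≤ b ≤ a`, and `0` otherwise. -/
noncomputable def intBinom (a b : ℤ) : ℤ :=
  if 0 ≤ b ∧ b ≤ a then (Nat.choose a.toNat b.toNat : ℤ) else 0

theorem intBinom_eq_zero_of_lt {a b : ℤ} (hab : a < b) : intBinom a b = 0 := by
  unfold intBinom
  rw [if_neg (by omega)]

theorem intBinom_of_neg {a b : ℤ} (hb : b < 0) : intBinom a b = 0 := by
  unfold intBinom
  rw [if_neg (by omega)]

theorem intBinom_natCast (a b : ℕ) : intBinom a b = (a.choose b : ℤ) := by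
  unfold intBinom
  split_ifs with hab
  · simp
  · rw [Nat.choose_eq_zero_of_lt (by omega), Nat.cast_zero]

/-- Pascal's rule fails for `intBinom` only at `(a, b) = (-1, -1)`. -/
theorem intBinom_succ_succ {a b : ℤ} (hab : 0 ≤ a ∨ b ≠ -1) :
    intBinom (a + 1) (b + 1) = intBinom a b + intBinom a (b + 1) := by
  rcases lt_or_ge a 0 with ha | ha
  · have hb : b ≠ -1 := by omega
    rcases lt_or_ge b 0 with hb' | hb'
    · rw [intBinom_of_neg hb', intBinom_of_neg (by omega), intBinom_of_neg (by omega), add_zero]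
    · rw [intBinom_eq_zero_of_lt (by omega), intBinom_eq_zero_of_lt (by omega),
        intBinom_eq_zero_of_lt (by omega), add_zero]
  · lift a to ℕ using ha
    rcases lt_trichotomy b (-1) with hb | rfl | hb
    · rw [intBinom_of_neg (by omega), intBinom_of_neg (by omega), intBinom_of_neg (by omega),
        add_zero]
    · have h1 := intBinom_natCast (a + 1) 0
      have h2 := intBinom_natCast a 0
      push_cast at h1 h2
      rw [intBinom_of_neg (b := -1) (by omega), neg_add_cancel, h1, h2]
      simp
    · lift b to ℕ using (by omega)
      have h1 := intBinom_natCast (a + 1) (b + 1)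
      have h2 := intBinom_natCast a (b + 1)
      push_cast at h1 h2
      rw [h1, h2, intBinom_natCast, Nat.choose_succ_succ]
      push_cast
      ring

theorem sum_Icc_intBinom {L U : ℕ} (hLU : L ≤ U) {c b : ℤ} (hc : c ≤ L ∨ b ≠ -1) :
    ∑ z ∈ Finset.Icc L U, intBinom ((z : ℤ) - c) b =
      intBinom ((U : ℤ) - c + 1) (b + 1) - intBinom ((L : ℤ) - c) (b + 1) := by
  induction U, hLU using Nat.le_induction with
  | base =>
    rw [Finset.Icc_self, Finset.sum_singleton, intBinom_succ_succ (by omega)]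
    ring
  | succ U hU ih =>
    rw [← Finset.insert_Icc_right_eq_Icc_add_one (by omega),
      Finset.sum_insert (by simp), ih]
    rw [intBinom_succ_succ (a := ((U + 1 : ℕ) : ℤ) - c) (by push_cast; omega)]
    push_cast
    rw [show (U : ℤ) - c + 1 = U + 1 - c by ring]
    ring

theorem det_eq_zero_of_zero_block {h : ℕ} (A : Matrix (Fin h) (Fin h) ℤ) (k : Fin h)
    (hA : ∀ i j, k ≤ i → j ≤ k → A i j = 0) : A.det = 0 := by
  rw [Matrix.det_apply]
  refine Finset.sum_eq_zero fun σ _ => ?_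
  obtain ⟨j, hj, hσ⟩ : ∃ j ≤ k, k ≤ σ j := by
    by_contra! hcon
    have hcard := Finset.card_le_card_of_injOn (s := Finset.Iic k) (t := Finset.Iio k) σ
      (fun j hj => by simpa using hcon j (by simpa using hj)) σ.injective.injOn
    simp at hcard
  have hprod : ∏ i, A (σ i) i = 0 :=
    Finset.prod_eq_zero (Finset.mem_univ j) (hA (σ j) j hσ hj)
  rw [hprod, smul_zero]

/-- The row of index `i` of the Kreweras matrix of parameter `r`, for the upper entry `z`. -/
noncomputable def krewerasRow {h : ℕ} (Y' : Fin h → ℕ) (r i z : ℕ) (j : Fin h) : ℤ :=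
  intBinom ((z : ℤ) - (Y' j : ℤ) + r) ((i : ℤ) - (j : ℤ) + r)

/-- The matrix whose first `k` rows have parameter `r + 1` and whose other rows have
parameter `r`. -/
noncomputable def mixedMatrix {h : ℕ} (Y' : Fin h → ℕ) (r k : ℕ) (Z : Fin h → ℕ) :
    Matrix (Fin h) (Fin h) ℤ :=
  Matrix.of fun i => krewerasRow Y' (if (i : ℕ) < k then r + 1 else r) i (Z i)

/-- The decreasing tuples between `Y'` and `Y` that agree with `Y` in the first `k` places. -/
noncomputable def decrSlice {h : ℕ} (Y' Y : Fin h → ℕ) (k : ℕ) : Finset (Fin h → ℕ) :=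
  (Finset.Icc Y' Y).filter fun Z => IsDecr h Z ∧ ∀ i : Fin h, (i : ℕ) < k → Z i = Y i

theorem mem_decrSlice {h : ℕ} {Y' Y : Fin h → ℕ} {k : ℕ} {Z : Fin h → ℕ} :
    Z ∈ decrSlice Y' Y k ↔ (∀ i, Y' i ≤ Z i) ∧ (∀ i, Z i ≤ Y i) ∧ IsDecr h Z ∧
      ∀ i : Fin h, (i : ℕ) < k → Z i = Y i := by
  simp [decrSlice, Pi.le_def, and_assoc]

/-- The least value allowed in place `k` by the entry of `W` that follows it. -/
def lowerBound {h : ℕ} (Y' W : Fin h → ℕ) (k : Fin h) : ℕ :=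
  if hk : (k : ℕ) + 1 < h then W ⟨k + 1, hk⟩ else Y' k

theorem le_lowerBound {h : ℕ} {Y' W : Fin h → ℕ} (hY' : IsDecr h Y') (hW : ∀ i, Y' i ≤ W i)
    {k j : Fin h} (hkj : k < j) : Y' j ≤ lowerBound Y' W k := by
  have hk : (k : ℕ) + 1 < h := by omega
  rw [lowerBound, dif_pos hk]
  exact (hY' ⟨k + 1, hk⟩ j (by simpa [Fin.le_def] using hkj)).trans (hW _)

theorem lowerBound_le {h : ℕ} {Y' W : Fin h → ℕ} (hW : ∀ i, Y' i ≤ W i)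
    (hd : IsDecr h W) (k : Fin h) : lowerBound Y' W k ≤ W k := by
  unfold lowerBound
  split_ifs with hk
  · exact hd _ _ (by simp [Fin.le_def])
  · exact hW k

theorem le_lowerBound_of_lt {h : ℕ} {Y' W : Fin h → ℕ} (hd : IsDecr h W) {k i : Fin h}
    (hki : k < i) : W i ≤ lowerBound Y' W k := by
  have hk : (k : ℕ) + 1 < h := by omega
  rw [lowerBound, dif_pos hk]
  exact hd _ _ (by simpa [Fin.le_def] using hki)

theorem lowerBound_update {h : ℕ} (Y' W : Fin h → ℕ) (k : Fin h) (z : ℕ) :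
    lowerBound Y' (Function.update W k z) k = lowerBound Y' W k := by
  unfold lowerBound
  split_ifs with hk
  · rw [Function.update_of_ne (by simp [Fin.ext_iff])]
  · rfl

theorem mixedMatrix_update {h : ℕ} (Y' W : Fin h → ℕ) (r : ℕ) (k : Fin h) (z : ℕ) :
    mixedMatrix Y' r k (Function.update W k z) =
      (mixedMatrix Y' r (k + 1) W).updateRow k (krewerasRow Y' r k z) := by
  ext i j
  by_cases hik : i = k
  · subst hik
    simp [mixedMatrix]
  · have : (i : ℕ) < k ↔ (i : ℕ) < k + 1 := by omega
    simp only [mixedMatrix, Matrix.of_apply, Matrix.updateRow_ne hik,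
      Function.update_of_ne hik, this]

theorem det_mixedMatrix_eq_zero {h : ℕ} {Y' Z : Fin h → ℕ} (hY' : IsDecr h Y') (r : ℕ) (k : Fin h)
    (hlt : ∀ i, k ≤ i → Z i < Y' k) : (mixedMatrix Y' r k Z).det = 0 := by
  refine det_eq_zero_of_zero_block _ k fun i j hi hj => ?_
  have h1 := hlt i hi
  have h2 := hY' j k hj
  have h3 : ¬ (i : ℕ) < k := by simpa using hi
  have h4 : (j : ℕ) ≤ i := hj.trans hi
  simp only [mixedMatrix, Matrix.of_apply, h3, if_false, krewerasRow]
  exact intBinom_eq_zero_of_lt (by omega)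

theorem sum_krewerasRow {h : ℕ} {Y' W : Fin h → ℕ} (hY' : IsDecr h Y') (hW : ∀ i, Y' i ≤ W i)
    (hd : IsDecr h W) (r : ℕ) (k : Fin h) :
    ∑ z ∈ Finset.Icc (lowerBound Y' W k) (W k), krewerasRow Y' r k z =
      krewerasRow Y' (r + 1) k (W k) - krewerasRow Y' r (k + 1) (lowerBound Y' W k) := by
  ext j
  rw [Finset.sum_apply, Pi.sub_apply]
  have := sum_Icc_intBinom (lowerBound_le hW hd k) (c := (Y' j : ℤ) - r)
    (b := (k : ℤ) - (j : ℤ) + r) (by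
      rcases lt_or_ge k j with hkj | hkj
      · have := le_lowerBound hY' hW hkj
        omega
      · omega)
  unfold krewerasRow
  convert this using 2
  · congr 1
    ring
  · congr 1 <;> push_cast <;> ring
  · congr 1 <;> push_cast <;> ring

theorem det_updateRow_krewerasRow {h : ℕ} {Y' W : Fin h → ℕ} (hY' : IsDecr h Y')
    (r : ℕ) (k : Fin h) :
    ((mixedMatrix Y' r (k + 1) W).updateRow k
      (krewerasRow Y' r (k + 1) (lowerBound Y' W k))).det = 0 := by
  by_cases hk : (k : ℕ) + 1 < h
  · refine Matrix.det_zero_of_row_eq (i := k) (j := ⟨k + 1, hk⟩) (by simp [Fin.ext_iff]) ?_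
    ext j
    rw [Matrix.updateRow_self, Matrix.updateRow_ne (by simp [Fin.ext_iff])]
    simp only [mixedMatrix, Matrix.of_apply, lowerBound, hk, dif_pos, lt_irrefl, if_false]
  · refine Matrix.det_eq_zero_of_row_eq_zero k fun j => ?_
    have hj : j ≤ k := by
      rw [Fin.le_def]
      omega
    have := hY' j k hj
    rw [Fin.le_def] at hj
    simp only [Matrix.updateRow_self, lowerBound, hk, dif_neg, not_false_eq_true, krewerasRow]
    exact intBinom_eq_zero_of_lt (by push_cast; omega)

theorem sum_det_mixedMatrix_update {h : ℕ} {Y' W : Fin h → ℕ} (hY' : IsDecr h Y')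
    (hW : ∀ i, Y' i ≤ W i) (hd : IsDecr h W) (r : ℕ) (k : Fin h) :
    ∑ z ∈ Finset.Icc (max (lowerBound Y' W k) (Y' k)) (W k),
        (mixedMatrix Y' r k (Function.update W k z)).det =
      (mixedMatrix Y' r (k + 1) W).det := by
  have hextend : ∑ z ∈ Finset.Icc (max (lowerBound Y' W k) (Y' k)) (W k),
        (mixedMatrix Y' r k (Function.update W k z)).det =
      ∑ z ∈ Finset.Icc (lowerBound Y' W k) (W k),
        (mixedMatrix Y' r k (Function.update W k z)).det := by
    refine Finset.sum_subset (Finset.Icc_subset_Icc_left (le_max_left _ _)) fun z hz hz' => ?_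
    rw [Finset.mem_Icc] at hz hz'
    refine det_mixedMatrix_eq_zero hY' r k fun i hi => ?_
    rcases hi.eq_or_lt with rfl | hi
    · rw [Function.update_self]
      omega
    · rw [Function.update_of_ne hi.ne']
      have := le_lowerBound_of_lt (Y' := Y') hd hi
      omega
  have hrow : (mixedMatrix Y' r (k + 1) W).updateRow k (krewerasRow Y' (r + 1) k (W k)) =
      mixedMatrix Y' r (k + 1) W := by
    conv_rhs => rw [← Matrix.updateRow_eq_self (mixedMatrix Y' r (k + 1) W) k]
    congr 1
    ext j
    simp [mixedMatrix]
  have hsum := (Matrix.detRowAlternating (R := ℤ) (n := Fin h)).toMultilinearMap.map_update_sum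
    (Finset.Icc (lowerBound Y' W k) (W k)) k (fun z => krewerasRow Y' r k z)
    (mixedMatrix Y' r (k + 1) W)
  have hsub := (Matrix.detRowAlternating (R := ℤ) (n := Fin h)).map_update_sub
    (mixedMatrix Y' r (k + 1) W) k (krewerasRow Y' (r + 1) k (W k))
    (krewerasRow Y' r (k + 1) (lowerBound Y' W k))
  rw [sum_krewerasRow hY' hW hd] at hsum
  rw [hextend]
  simp_rw [mixedMatrix_update]
  refine hsum.symm.trans (hsub.trans ?_)
  refine (congrArg₂ (· - ·) (congrArg Matrix.det hrow)
    (det_updateRow_krewerasRow hY' r k)).trans (sub_zero _)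

theorem update_mem_decrSlice {h : ℕ} {Y' Y W : Fin h → ℕ} {k : Fin h} {z : ℕ}
    (hY : IsDecr h Y) (hW : W ∈ decrSlice Y' Y (k + 1))
    (hz : z ∈ Finset.Icc (max (lowerBound Y' W k) (Y' k)) (Y k)) :
    Function.update W k z ∈ decrSlice Y' Y k := by
  rw [mem_decrSlice] at hW ⊢
  obtain ⟨h1, h2, h3, h4⟩ := hW
  rw [Finset.mem_Icc, max_le_iff] at hz
  refine ⟨fun i => ?_, fun i => ?_, fun i j hij => ?_, fun i hi => ?_⟩
  · rcases eq_or_ne i k with rfl | hik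
    · simpa using hz.1.2
    · simpa [hik] using h1 i
  · rcases eq_or_ne i k with rfl | hik
    · simpa using hz.2
    · simpa [hik] using h2 i
  · rcases eq_or_ne i k with rfl | hik
    · rcases hij.eq_or_lt with rfl | hij
      · rfl
      · rw [Function.update_self, Function.update_of_ne hij.ne']
        exact (le_lowerBound_of_lt h3 hij).trans hz.1.1
    · rcases eq_or_ne j k with rfl | hjk
      · rw [Function.update_self, Function.update_of_ne hik, h4 i (Nat.lt_succ_of_le hij)]
        exact hz.2.trans (hY _ _ hij)
      · simpa [hik, hjk] using h3 i j hij
  · rw [Function.update_of_ne (by rintro rfl; omega)]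
    exact h4 i (by omega)

theorem update_top_mem_decrSlice {h : ℕ} {Y' Y Z : Fin h → ℕ} {k : Fin h}
    (hY : IsDecr h Y) (hZ : Z ∈ decrSlice Y' Y k) :
    Function.update Z k (Y k) ∈ decrSlice Y' Y (k + 1) := by
  rw [mem_decrSlice] at hZ ⊢
  obtain ⟨h1, h2, h3, h4⟩ := hZ
  refine ⟨fun i => ?_, fun i => ?_, fun i j hij => ?_, fun i hi => ?_⟩
  · rcases eq_or_ne i k with rfl | hik
    · simpa using (h1 i).trans (h2 i)
    · simpa [hik] using h1 i
  · rcases eq_or_ne i k with rfl | hik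
    · simp
    · simpa [hik] using h2 i
  · rcases eq_or_ne i k with rfl | hik
    · rcases eq_or_ne j i with rfl | hji
      · rfl
      · simpa [hji] using (h2 j).trans (hY i j hij)
    · rcases eq_or_ne j k with rfl | hjk
      · rw [Function.update_self, Function.update_of_ne hik,
          h4 i (lt_of_le_of_ne hij (Fin.val_ne_of_ne hik))]
        exact hY _ _ hij
      · simpa [hik, hjk] using h3 i j hij
  · rcases eq_or_ne i k with rfl | hik
    · simp
    · rw [Function.update_of_ne hik]
      exact h4 i (by omega)

theorem sum_decrSlice_succ {h : ℕ} {Y' Y : Fin h → ℕ} (hY : IsDecr h Y) (k : Fin h)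
    (F : (Fin h → ℕ) → ℤ) :
    ∑ Z ∈ decrSlice Y' Y k, F Z = ∑ W ∈ decrSlice Y' Y (k + 1),
      ∑ z ∈ Finset.Icc (max (lowerBound Y' W k) (Y' k)) (Y k), F (Function.update W k z) := by
  rw [Finset.sum_sigma']
  refine Finset.sum_bij' (fun Z _ => ⟨Function.update Z k (Y k), Z k⟩)
    (fun p _ => Function.update p.1 k p.2) (fun Z hZ => ?_) (fun p hp => ?_) (fun Z hZ => ?_)
    (fun p hp => ?_) (fun Z hZ => ?_)
  · rw [Finset.mem_sigma]
    refine ⟨update_top_mem_decrSlice hY hZ, ?_⟩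
    rw [mem_decrSlice] at hZ
    rw [lowerBound_update, Finset.mem_Icc, max_le_iff]
    exact ⟨⟨lowerBound_le hZ.1 hZ.2.2.1 k, hZ.1 k⟩, hZ.2.1 k⟩
  · rw [Finset.mem_sigma] at hp
    exact update_mem_decrSlice hY hp.1 hp.2
  · simp
  · rw [Finset.mem_sigma, mem_decrSlice] at hp
    obtain ⟨W, z⟩ := p
    have : Y k = W k := (hp.1.2.2.2 k (Nat.lt_succ_self _)).symm
    simp [this]
  · simp

theorem sum_det_mixedMatrix {h : ℕ} {Y' Y : Fin h → ℕ} (hY : IsDecr h Y) (hY' : IsDecr h Y')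
    (r k : ℕ) (hk : k ≤ h) :
    ∑ Z ∈ decrSlice Y' Y 0, (mixedMatrix Y' r 0 Z).det =
      ∑ Z ∈ decrSlice Y' Y k, (mixedMatrix Y' r k Z).det := by
  induction k with
  | zero => rfl
  | succ k ih =>
    rw [ih (by omega), sum_decrSlice_succ hY ⟨k, hk⟩]
    refine Finset.sum_congr rfl fun W hW => ?_
    rw [mem_decrSlice] at hW
    rw [← hW.2.2.2 ⟨k, hk⟩ (Nat.lt_succ_self k)]
    exact sum_det_mixedMatrix_update hY' hW.1 hW.2.2.1 r ⟨k, hk⟩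

theorem decrSlice_self {h : ℕ} {Y' Y : Fin h → ℕ} (hY : IsDecr h Y) (hle : ∀ i, Y' i ≤ Y i) :
    decrSlice Y' Y h = {Y} := by
  ext Z
  rw [mem_decrSlice, Finset.mem_singleton]
  constructor
  · rintro ⟨-, -, -, hZ⟩
    exact funext fun i => hZ i i.2
  · rintro rfl
    exact ⟨hle, fun _ => le_rfl, hY, fun _ _ => rfl⟩

/-- The multichains of length `r` of decreasing tuples between `Y'` and `Y`. -/
def multichains {h : ℕ} (Y' Y : Fin h → ℕ) (r : ℕ) : Set (Fin r → Fin h → ℕ) :=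
  {Z | (∀ k, IsDecr h (Z k)) ∧ (∀ k i, Y' i ≤ Z k i) ∧ (∀ k i, Z k i ≤ Y i) ∧
    (∀ k l : Fin r, k ≤ l → ∀ i, Z k i ≤ Z l i)}

theorem finite_multichains {h : ℕ} (Y' Y : Fin h → ℕ) (r : ℕ) : (multichains Y' Y r).Finite :=
  (Set.finite_Icc (fun _ => Y') (fun _ => Y)).subset fun _ hZ => ⟨hZ.2.1, hZ.2.2.1⟩

theorem snoc_mem_multichains {h r : ℕ} {Y' Y W : Fin h → ℕ} {Z : Fin r → Fin h → ℕ} :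
    (Fin.snoc Z W : Fin (r + 1) → Fin h → ℕ) ∈ multichains Y' Y (r + 1) ↔
      W ∈ decrSlice Y' Y 0 ∧ Z ∈ multichains Y' W r := by
  rw [mem_decrSlice]
  simp only [multichains, Set.mem_ofPred_eq, Fin.forall_fin_succ', Fin.snoc_castSucc,
    Fin.snoc_last, Fin.castSucc_le_castSucc_iff, Fin.le_last, true_implies, le_refl,
    Fin.last_le_iff, Fin.castSucc_ne_last, false_implies, implies_true, and_true,
    Nat.not_lt_zero]
  constructor
  · rintro ⟨⟨h1, h2⟩, ⟨h3, h4⟩, ⟨-, h5⟩, h6⟩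
    exact ⟨⟨h4, h5, h2⟩, h1, h3, fun k => (h6 k).2, fun k => (h6 k).1⟩
  · rintro ⟨⟨h4, h5, h2⟩, h1, h3, h7, h6⟩
    exact ⟨⟨h1, h2⟩, ⟨h3, h4⟩, ⟨fun k i => (h7 k i).trans (h5 i), h5⟩,
      fun k => ⟨h6 k, h7 k⟩⟩

theorem ncard_multichains_succ {h : ℕ} (Y' Y : Fin h → ℕ) (r : ℕ) :
    (multichains Y' Y (r + 1)).ncard =
      ∑ W ∈ decrSlice Y' Y 0, (multichains Y' W r).ncard := by
  rw [Set.ncard_eq_toFinset_card _ (finite_multichains Y' Y (r + 1)),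
    Finset.card_eq_sum_card_fiberwise (f := fun Z => Z (Fin.last r)) (t := decrSlice Y' Y 0)]
  · refine Finset.sum_congr rfl fun W hW => ?_
    rw [Set.ncard_eq_toFinset_card _ (finite_multichains Y' W r)]
    refine Finset.card_bij' (fun Z _ => Fin.init Z) (fun Z _ => Fin.snoc Z W)
      (fun Z hZ => ?_) (fun Z hZ => ?_) (fun Z hZ => ?_) (fun Z hZ => ?_)
    · rw [Finset.mem_filter, Set.Finite.mem_toFinset, ← Fin.snoc_init_self Z,
        snoc_mem_multichains, Fin.snoc_last] at hZ
      rw [Set.Finite.mem_toFinset, ← hZ.2]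
      simpa using hZ.1.2
    · rw [Set.Finite.mem_toFinset] at hZ
      rw [Finset.mem_filter, Set.Finite.mem_toFinset, snoc_mem_multichains, Fin.snoc_last]
      exact ⟨⟨hW, hZ⟩, rfl⟩
    · rw [Finset.mem_filter] at hZ
      rw [← hZ.2]
      exact Fin.snoc_init_self Z
    · exact Fin.init_snoc _ _
  · intro Z hZ
    rw [Finset.mem_coe, Set.Finite.mem_toFinset, ← Fin.snoc_init_self Z,
      snoc_mem_multichains] at hZ
    exact hZ.1

theorem det_mixedMatrix_zero_zero {h : ℕ} {Y' Y : Fin h → ℕ} (hle : ∀ i, Y' i ≤ Y i) :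
    (mixedMatrix Y' 0 0 Y).det = 1 := by
  rw [Matrix.det_of_isLowerTriangular]
  · refine Finset.prod_eq_one fun i _ => ?_
    have := hle i
    simp [mixedMatrix, krewerasRow, intBinom, this]
  · intro i j hij
    have hij : (i : ℕ) < j := hij
    simp only [mixedMatrix, Matrix.of_apply, krewerasRow, Nat.not_lt_zero, if_false]
    exact intBinom_of_neg (by push_cast; omega)

theorem ncard_multichains {h : ℕ} {Y' Y : Fin h → ℕ} (hY : IsDecr h Y) (hY' : IsDecr h Y')
    (hle : ∀ i, Y' i ≤ Y i) (r : ℕ) :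
    ((multichains Y' Y r).ncard : ℤ) = (mixedMatrix Y' r 0 Y).det := by
  induction r generalizing Y with
  | zero =>
    have : multichains Y' Y 0 = Set.univ := by
      ext Z
      simp [multichains]
    rw [this, Set.ncard_univ, Nat.card_unique, det_mixedMatrix_zero_zero hle, Nat.cast_one]
  | succ r ih =>
    rw [ncard_multichains_succ, Nat.cast_sum]
    have hsum : ∑ W ∈ decrSlice Y' Y 0, ((multichains Y' W r).ncard : ℤ) =
        ∑ W ∈ decrSlice Y' Y 0, (mixedMatrix Y' r 0 W).det := by
      refine Finset.sum_congr rfl fun W hW => ?_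
      rw [mem_decrSlice] at hW
      exact ih hW.2.2.1 hW.1
    rw [hsum, sum_det_mixedMatrix hY hY' r h le_rfl, decrSlice_self hY hle,
      Finset.sum_singleton]
    congr 1
    ext i j
    simp [mixedMatrix]

/-- **Kreweras's determinant formula** : the number `w_r` of multichains
`Y' ≤ Z₁ ≤ ⋯ ≤ Z_r ≤ Y` of weakly decreasing `h`-tuples equals
`det ( C(y_i − y'_j + r, i − j + r) )_{i,j}`. -/
theorem kreweras_determinant (h : ℕ) (hh : 1 ≤ h) (Y Y' : Fin h → ℕ)
    (hY : IsDecr h Y) (hY' : IsDecr h Y') (hle : ∀ i, Y' i ≤ Y i) (r : ℕ) :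
    (Set.ncard {Z : Fin r → Fin h → ℕ |
        (∀ k, IsDecr h (Z k)) ∧
        (∀ k i, Y' i ≤ Z k i) ∧ (∀ k i, Z k i ≤ Y i) ∧
        (∀ k l : Fin r, k ≤ l → ∀ i, Z k i ≤ Z l i)} : ℤ) =
      Matrix.det (Matrix.of fun i j : Fin h =>
        intBinom ((Y i : ℤ) - (Y' j : ℤ) + r) ((i : ℤ) - (j : ℤ) + r)) := by
  exact ncard_multichains hY hY' hle r
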